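/- Let e_y ∈ ℝ^r with 1_rᵀ e_y = 0 and e_x ∈ ℝ^N with Uᵀ e_x = 0 and W e_x = e_x. Assume: (i) cE > 0 satisfies vᵀLᴱv ≤ cE‖v‖² for all v ∈ ℝ^N; (ii) sE > 0 satisfies vᵀLᴱv ≥ sE‖v‖² for every v ∈ ℝ^N with 1_Nᵀv = 0 and (Uw)ᵀLᴱ(Uw) ≥ sE‖Uw‖² for every w ∈ ℝ^r with 1_rᵀw = 0; (iii) sI > 0 satisfies vᵀLᴵv ≥ sI‖v‖² for every v ∈ ℝ^N with Uᵀv = 0; (iv) P commutes with UᵀLᴱU; (v) sI ≥ 2 cE² N_max² / (sE N_min²); and set ε = N_min sE / (2 N_max² cE). Then the combined derivative bound of the two Lyapunov functions satisfies [−½ e_yᵀP⁻¹UᵀLᴱU e_y + (1/(2N_min)) e_xᵀLᴱe_x] + ε[−e_xᵀWLᴵe_x − ½ e_xᵀWLᴱe_x + ½ e_yᵀUᵀLᴱUe_y] ≤ −(N_min sE/(2N_max)) (½‖e_y‖² + (ε/2)‖e_x‖²). -/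

import Mathlib

open Matrix

noncomputable section

/-- The node set of a network of `r` clusters with sizes `Nv α`. -/
abbrev ClusterNode (r : ℕ) (Nv : Fin r → ℕ) := (α : Fin r) × Fin (Nv α)

/-- `U = diag(1_{N_1},…,1_{N_r}) ∈ ℝ^{N×r}`, the block-diagonal matrix whose
`α`-th column block is the all-ones vector `1_{N_α}`. -/
def clusterU (r : ℕ) (Nv : Fin r → ℕ) : Matrix (ClusterNode r Nv) (Fin r) ℝ :=
  Matrix.of fun v β => if v.1 = β then (1 : ℝ) else 0

/-- `P = diag(N_1,…,N_r) ∈ ℝ^{r×r}`. -/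
def clusterP (r : ℕ) (Nv : Fin r → ℕ) : Matrix (Fin r) (Fin r) ℝ :=
  Matrix.diagonal fun α => (Nv α : ℝ)

/-- `P⁻¹ = diag(1/N_1,…,1/N_r) ∈ ℝ^{r×r}`. -/
def clusterPinv (r : ℕ) (Nv : Fin r → ℕ) : Matrix (Fin r) (Fin r) ℝ :=
  Matrix.diagonal fun α => ((Nv α : ℝ))⁻¹

/-- The centering matrix `W_n = I_n − (1/n) 1_n 1_nᵀ`. -/
def centering (n : ℕ) : Matrix (Fin n) (Fin n) ℝ :=
  (1 : Matrix (Fin n) (Fin n) ℝ) - ((n : ℝ)⁻¹) • Matrix.of fun _ _ => (1 : ℝ)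

/-- `W = diag(W_1,…,W_r)` the block-diagonal centering matrix. -/
def clusterW (r : ℕ) (Nv : Fin r → ℕ) : Matrix (ClusterNode r Nv) (ClusterNode r Nv) ℝ :=
  Matrix.blockDiagonal' fun α => centering (Nv α)

/-- The slow variable `y = P⁻¹ Uᵀ x`. -/
def slowVar (r : ℕ) (Nv : Fin r → ℕ) (x : ClusterNode r Nv → ℝ) : Fin r → ℝ :=
  clusterPinv r Nv *ᵥ ((clusterU r Nv)ᵀ *ᵥ x)

/-- The fast variable `e_x = W x`. -/
def fastVar (r : ℕ) (Nv : Fin r → ℕ) (x : ClusterNode r Nv → ℝ) : ClusterNode r Nv → ℝ :=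
  clusterW r Nv *ᵥ x

/-- The inter-area variable `e_y = W_r y`. -/
def interArea (r : ℕ) (Nv : Fin r → ℕ) (x : ClusterNode r Nv → ℝ) : Fin r → ℝ :=
  centering r *ᵥ slowVar r Nv x

/-- Reading the entries of `U *ᵥ w`. -/
theorem clusterU_mulVec_apply (r : ℕ) (Nv : Fin r → ℕ) (w : Fin r → ℝ)
    (v : ClusterNode r Nv) : (clusterU r Nv *ᵥ w) v = w v.1 := by
  simp [clusterU, Matrix.mulVec, dotProduct]

theorem clusterU_mulVec_dotProduct_self (r : ℕ) (Nv : Fin r → ℕ) (w : Fin r → ℝ) :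
    (clusterU r Nv *ᵥ w) ⬝ᵥ (clusterU r Nv *ᵥ w) = ∑ α, (Nv α : ℝ) * (w α * w α) := by
  simp [dotProduct, clusterU_mulVec_apply, Fintype.sum_sigma]

/-- A vector annihilated by `Uᵀ` has zero sum. -/
theorem sum_eq_zero_of_clusterU_transpose_mulVec (r : ℕ) (Nv : Fin r → ℕ)
    (x : ClusterNode r Nv → ℝ) (hx : (clusterU r Nv)ᵀ *ᵥ x = 0) : ∑ i, x i = 0 := by
  have hU : clusterU r Nv *ᵥ (fun _ => (1 : ℝ)) = fun _ => 1 :=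
    funext fun v => clusterU_mulVec_apply r Nv _ v
  have h : x ⬝ᵥ (clusterU r Nv *ᵥ fun _ => (1 : ℝ)) = 0 := by
    rw [Matrix.dotProduct_mulVec, ← Matrix.mulVec_transpose, hx, zero_dotProduct]
  rw [hU] at h
  simpa [dotProduct] using h

theorem clusterW_transpose (r : ℕ) (Nv : Fin r → ℕ) : (clusterW r Nv)ᵀ = clusterW r Nv := by
  unfold clusterW
  rw [Matrix.blockDiagonal'_transpose]
  congr 1
  funext α
  ext i j
  simp [centering, Matrix.one_apply, eq_comm]

theorem dotProduct_clusterW_mulVec (r : ℕ) (Nv : Fin r → ℕ) {x : ClusterNode r Nv → ℝ}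
    (hx : clusterW r Nv *ᵥ x = x) (z : ClusterNode r Nv → ℝ) :
    x ⬝ᵥ (clusterW r Nv *ᵥ z) = x ⬝ᵥ z := by
  rw [Matrix.dotProduct_mulVec, ← Matrix.mulVec_transpose, clusterW_transpose, hx]

/-- If a positive semidefinite matrix commutes with `diagonal d`, then multiplying it by any
nonnegative function of `d` keeps its quadratic form nonnegative. -/
theorem dotProduct_diagonal_comp_mulVec_nonneg {n : Type*} [Fintype n] [DecidableEq n]
    {M : Matrix n n ℝ} (hM : M.PosSemidef) {d : n → ℝ}
    (hcomm : Matrix.diagonal d * M = M * Matrix.diagonal d) (f : ℝ → ℝ)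
    (hf : ∀ i, 0 ≤ f (d i)) (x : n → ℝ) :
    0 ≤ x ⬝ᵥ (Matrix.diagonal (fun i => f (d i)) *ᵥ (M *ᵥ x)) := by
  have hz := hM.dotProduct_mulVec_nonneg (fun i => √(f (d i)) * x i)
  refine hz.trans_eq ?_
  simp only [dotProduct, Matrix.mulVec_diagonal, Pi.star_apply, star_trivial]
  simp only [Matrix.mulVec, dotProduct, Finset.mul_sum]
  refine Finset.sum_congr rfl fun i _ => Finset.sum_congr rfl fun j _ => ?_
  have hij : d i * M i j = M i j * d j := by
    simpa using congrFun (congrFun hcomm i) j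
  rcases eq_or_ne (M i j) 0 with h0 | h0
  · simp [h0]
  · have hd : d i = d j := mul_right_cancel₀ h0 (hij.trans (mul_comm _ _))
    have hs := Real.mul_self_sqrt (hf i)
    rw [← hd]
    linear_combination (x i * M i j * x j) * hs

theorem dotProduct_conj_mulVec {m n : Type*} [Fintype m] [Fintype n]
    (A : Matrix m m ℝ) (B : Matrix m n ℝ) (x : n → ℝ) :
    x ⬝ᵥ ((Bᵀ * A * B) *ᵥ x) = (B *ᵥ x) ⬝ᵥ (A *ᵥ (B *ᵥ x)) := by
  rw [← Matrix.mulVec_mulVec, ← Matrix.mulVec_mulVec, Matrix.dotProduct_mulVec,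
    ← Matrix.mulVec_transpose, Matrix.transpose_transpose]

/-- The slow part of the bound: `P⁻¹` is bounded below by `1 / N_max` on the quadratic form of
`UᵀLᴱU`. -/
theorem clusterPinv_quadratic_lower_bound (r : ℕ) (Nv : Fin r → ℕ) (hNv : ∀ α, 0 < Nv α)
    {LE : Matrix (ClusterNode r Nv) (ClusterNode r Nv) ℝ} (hLE : LE.PosSemidef)
    (hcomm : clusterP r Nv * ((clusterU r Nv)ᵀ * LE * clusterU r Nv) =
      ((clusterU r Nv)ᵀ * LE * clusterU r Nv) * clusterP r Nv)
    {Nmax : ℕ} (hle : ∀ α, Nv α ≤ Nmax) (y : Fin r → ℝ) :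
    (Nmax : ℝ)⁻¹ * ((clusterU r Nv *ᵥ y) ⬝ᵥ (LE *ᵥ (clusterU r Nv *ᵥ y))) ≤
      y ⬝ᵥ (clusterPinv r Nv *ᵥ ((clusterU r Nv)ᵀ *ᵥ (LE *ᵥ (clusterU r Nv *ᵥ y)))) := by
  have hM : ((clusterU r Nv)ᵀ * LE * clusterU r Nv).PosSemidef := by
    simpa using hLE.conjTranspose_mul_mul_same (clusterU r Nv)
  have h := dotProduct_diagonal_comp_mulVec_nonneg hM hcomm (fun t => t⁻¹ - (Nmax : ℝ)⁻¹)
    (fun α => sub_nonneg.2 (inv_anti₀ (by exact_mod_cast hNv α) (by exact_mod_cast hle α))) y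
  have hd : Matrix.diagonal (fun α => ((Nv α : ℝ))⁻¹ - (Nmax : ℝ)⁻¹) =
      clusterPinv r Nv - (Nmax : ℝ)⁻¹ • 1 := by
    rw [clusterPinv, Matrix.smul_one_eq_diagonal, Matrix.diagonal_sub]
  rw [hd, Matrix.sub_mulVec, dotProduct_sub, Matrix.smul_mulVec, Matrix.one_mulVec,
    dotProduct_smul, dotProduct_conj_mulVec, smul_eq_mul, sub_nonneg] at h
  simpa only [Matrix.mulVec_mulVec, Matrix.mul_assoc] using h

/-- The combined Lyapunov derivative bound: under assumptions (i)–(v) and the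
choice of `ε`, the sum of the bounds from Lemma 3 and `ε` times Lemma 4 is at
most `−(N_min sE/(2N_max)) (½‖e_y‖² + (ε/2)‖e_x‖²)`. -/
theorem combined_lyapunov_derivative_bound
    (r : ℕ) (Nv : Fin r → ℕ) (hNv : ∀ α, 0 < Nv α)
    (Lb : ∀ α : Fin r, Matrix (Fin (Nv α)) (Fin (Nv α)) ℝ)
    (hLb : ∀ α, (Lb α).PosSemidef)
    (hLb1 : ∀ α, Lb α *ᵥ (fun _ => (1 : ℝ)) = 0)
    (LE : Matrix (ClusterNode r Nv) (ClusterNode r Nv) ℝ)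
    (hLE : LE.PosSemidef)
    (hLE1 : LE *ᵥ (fun _ => (1 : ℝ)) = 0)
    (Nmin Nmax : ℕ)
    (hNmin : IsLeast (Set.range Nv) Nmin)
    (hNmax : IsGreatest (Set.range Nv) Nmax)
    -- (i) spectral-norm bound on Lᴱ
    (cE : ℝ) (hcE : 0 < cE)
    (hcEbound : ∀ v : ClusterNode r Nv → ℝ, v ⬝ᵥ (LE *ᵥ v) ≤ cE * (v ⬝ᵥ v))
    -- (ii) spectral gaps of Lᴱ
    (sE : ℝ) (hsE : 0 < sE)
    (hsEgap : ∀ v : ClusterNode r Nv → ℝ, (∑ i, v i) = 0 →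
      sE * (v ⬝ᵥ v) ≤ v ⬝ᵥ (LE *ᵥ v))
    (hsEgapU : ∀ w : Fin r → ℝ, (∑ α, w α) = 0 →
      sE * ((clusterU r Nv *ᵥ w) ⬝ᵥ (clusterU r Nv *ᵥ w)) ≤
        (clusterU r Nv *ᵥ w) ⬝ᵥ (LE *ᵥ (clusterU r Nv *ᵥ w)))
    -- (iii) spectral gap of the internal Laplacian
    (sI : ℝ) (hsI : 0 < sI)
    (hsIgap : ∀ v : ClusterNode r Nv → ℝ, (clusterU r Nv)ᵀ *ᵥ v = 0 →
      sI * (v ⬝ᵥ v) ≤ v ⬝ᵥ (Matrix.blockDiagonal' Lb *ᵥ v))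
    -- (iv) P commutes with UᵀLᴱU
    (hcomm : clusterP r Nv * ((clusterU r Nv)ᵀ * LE * clusterU r Nv) =
      ((clusterU r Nv)ᵀ * LE * clusterU r Nv) * clusterP r Nv)
    -- (v) cluster-strength condition
    (hstrength : sI ≥ 2 * cE ^ 2 * (Nmax : ℝ) ^ 2 / (sE * (Nmin : ℝ) ^ 2))
    (ε : ℝ) (hε : ε = (Nmin : ℝ) * sE / (2 * (Nmax : ℝ) ^ 2 * cE))
    (ey : Fin r → ℝ) (hey : (∑ α, ey α) = 0)
    (ex : ClusterNode r Nv → ℝ)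
    (hUex : (clusterU r Nv)ᵀ *ᵥ ex = 0)
    (hWex : clusterW r Nv *ᵥ ex = ex) :
    (-(1 / 2) * (ey ⬝ᵥ (clusterPinv r Nv *ᵥ ((clusterU r Nv)ᵀ *ᵥ
          (LE *ᵥ (clusterU r Nv *ᵥ ey)))))
        + (1 / (2 * (Nmin : ℝ))) * (ex ⬝ᵥ (LE *ᵥ ex)))
      + ε * (-(ex ⬝ᵥ (clusterW r Nv *ᵥ (Matrix.blockDiagonal' Lb *ᵥ ex)))
          - (1 / 2) * (ex ⬝ᵥ (clusterW r Nv *ᵥ (LE *ᵥ ex)))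
          + (1 / 2) * ((clusterU r Nv *ᵥ ey) ⬝ᵥ (LE *ᵥ (clusterU r Nv *ᵥ ey))))
      ≤ -((Nmin : ℝ) * sE / (2 * (Nmax : ℝ))) *
          ((1 / 2) * (ey ⬝ᵥ ey) + (ε / 2) * (ex ⬝ᵥ ex)) := by
  obtain ⟨⟨α₀, hα₀⟩, hmin⟩ := hNmin
  have hm : (0 : ℝ) < Nmin := by
    rw [← hα₀]
    exact_mod_cast hNv α₀
  have hmin' : ∀ α, (Nmin : ℝ) ≤ Nv α := fun α => by exact_mod_cast hmin ⟨α, rfl⟩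
  have hmax : ∀ α, Nv α ≤ Nmax := fun α => hNmax.2 ⟨α, rfl⟩
  have hmax' : ∀ α, (Nv α : ℝ) ≤ Nmax := fun α => by exact_mod_cast hmax α
  have hmK : (Nmin : ℝ) ≤ Nmax := (hmin' α₀).trans (hmax' α₀)
  have hK : (0 : ℝ) < Nmax := hm.trans_le hmK
  have hεpos : 0 < ε := by rw [hε]; positivity
  rw [dotProduct_clusterW_mulVec r Nv hWex, dotProduct_clusterW_mulVec r Nv hWex]
  have hp := clusterPinv_quadratic_lower_bound r Nv hNv hLE hcomm hmax ey
  have hqlow := hsEgapU ey hey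
  have hqupp := hcEbound (clusterU r Nv *ᵥ ey)
  have hUlow : (Nmin : ℝ) * (ey ⬝ᵥ ey) ≤ (clusterU r Nv *ᵥ ey) ⬝ᵥ (clusterU r Nv *ᵥ ey) := by
    rw [clusterU_mulVec_dotProduct_self, dotProduct, Finset.mul_sum]
    exact Finset.sum_le_sum fun α _ =>
      mul_le_mul_of_nonneg_right (hmin' α) (mul_self_nonneg _)
  have hUupp : (clusterU r Nv *ᵥ ey) ⬝ᵥ (clusterU r Nv *ᵥ ey) ≤ (Nmax : ℝ) * (ey ⬝ᵥ ey) := by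
    rw [clusterU_mulVec_dotProduct_self, dotProduct, Finset.mul_sum]
    exact Finset.sum_le_sum fun α _ =>
      mul_le_mul_of_nonneg_right (hmax' α) (mul_self_nonneg _)
  have hXlow := hsEgap ex (sum_eq_zero_of_clusterU_transpose_mulVec r Nv ex hUex)
  have hXupp := hcEbound ex
  have hI := hsIgap ex hUex
  have hB : 0 ≤ ex ⬝ᵥ ex := Finset.sum_nonneg fun i _ => mul_self_nonneg _
  generalize ey ⬝ᵥ (clusterPinv r Nv *ᵥ ((clusterU r Nv)ᵀ *ᵥ
    (LE *ᵥ (clusterU r Nv *ᵥ ey)))) = p at *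
  generalize (clusterU r Nv *ᵥ ey) ⬝ᵥ (LE *ᵥ (clusterU r Nv *ᵥ ey)) = q at *
  generalize (clusterU r Nv *ᵥ ey) ⬝ᵥ (clusterU r Nv *ᵥ ey) = u at *
  generalize ex ⬝ᵥ (Matrix.blockDiagonal' Lb *ᵥ ex) = I at *
  generalize ex ⬝ᵥ (LE *ᵥ ex) = X at *
  generalize ex ⬝ᵥ ex = B at *
  generalize ey ⬝ᵥ ey = A at *
  generalize (Nmin : ℝ) = m at *
  generalize (Nmax : ℝ) = K at *
  have hslow : -(1 / 2) * p + ε * (1 / 2 * q) ≤ -(m * sE / (2 * K)) * (1 / 2 * A) := by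
    have hq₁ : K⁻¹ * (sE * (m * A)) ≤ K⁻¹ * q := by
      have := mul_le_mul_of_nonneg_left hUlow hsE.le
      gcongr
      linarith
    have hq₂ : ε * q ≤ ε * (cE * (K * A)) := by
      have := mul_le_mul_of_nonneg_left hUupp hcE.le
      gcongr
      linarith
    have e₁ : ε * (cE * (K * A)) = 1 / 2 * (K⁻¹ * (sE * (m * A))) := by
      rw [hε]; field_simp
    have e₂ : m * sE / (2 * K) * (1 / 2 * A) = 1 / 4 * (K⁻¹ * (sE * (m * A))) := by
      ring
    linarith
  have hfast : 1 / (2 * m) * X + ε * (-I - 1 / 2 * X) ≤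
      -(m * sE / (2 * K)) * (ε / 2 * B) := by
    have h₁ : cE / m * B ≤ ε * I := by
      have e : ε * (2 * cE ^ 2 * K ^ 2 / (sE * m ^ 2)) = cE / m := by
        rw [hε]; field_simp
      calc cE / m * B = ε * (2 * cE ^ 2 * K ^ 2 / (sE * m ^ 2) * B) := by rw [← e]; ring
        _ ≤ ε * (sI * B) := by gcongr
        _ ≤ ε * I := by gcongr
    have h₂ : 1 / (2 * m) * X ≤ 1 / 2 * (cE / m * B) := by
      calc 1 / (2 * m) * X ≤ 1 / (2 * m) * (cE * B) := by gcongr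
        _ = 1 / 2 * (cE / m * B) := by field_simp
    have h₃ : m * sE / (2 * K) * (ε / 2 * B) ≤ 1 / 2 * (ε * X) := by
      have hc : m * sE / (2 * K) ≤ sE := by
        rw [div_le_iff₀ (by positivity)]
        nlinarith
      calc m * sE / (2 * K) * (ε / 2 * B) ≤ sE * (ε / 2 * B) := by gcongr
        _ = ε / 2 * (sE * B) := by ring
        _ ≤ ε / 2 * X := by gcongr
        _ = 1 / 2 * (ε * X) := by ring
    have h₄ : 0 ≤ cE / m * B := by positivity
    linarith
  linarith
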